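/- arXiv:1904.02482 — 2 statements merged into one kernel-verified Lean document; each statement's English description precedes it below -/
import Mathlib

section
/- Let G be a finite simple graph of order n, and let a, b, n', m, Δ be non-negative integers with b − Δ ≥ a ≥ 2, δ(G) ≥ b(b−Δ)/(a+Δ) + m + n', and n > (a+b)(a+b+2m−2)/(a+Δ) + n'. Let g, f be integer-valued functions on V(G) with a ≤ g(x) ≤ f(x) − Δ ≤ b − Δ for every vertex x. If for every pair of distinct non-adjacent vertices u, v of G we have d_G(u) + d_G(v) ≥ 2((b−Δ)n + (a+Δ)n')/(a+b), then G is a fractional (g,f,n',m)-critical deleted graph. -/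
open Classical Finset

/-- The fractional degree `d_G^h(x)` of a vertex: the sum of `h e` over all edges
(unordered pairs) containing `x`. -/
noncomputable def fracDeg {V : Type*} [Fintype V] [DecidableEq V]
    (h : Sym2 V → ℝ) (x : V) : ℝ :=
  ∑ e ∈ Finset.univ.filter (fun e : Sym2 V => x ∈ e), h e

/-- `G` admits a fractional `(g,f)`-factor: a weighting `h : E(G) → [0,1]`
(extended by `0` off the edge set) with `g x ≤ d_G^h(x) ≤ f x` for every vertex. -/
def HasFracFactor {V : Type*} [Fintype V] [DecidableEq V]
    (G : SimpleGraph V) (g f : V → ℤ) : Prop :=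
  ∃ h : Sym2 V → ℝ,
    (∀ e, 0 ≤ h e ∧ h e ≤ 1) ∧
    (∀ e, e ∉ G.edgeSet → h e = 0) ∧
    (∀ x : V, (g x : ℝ) ≤ fracDeg h x ∧ fracDeg h x ≤ (f x : ℝ))

/-- `G` is a fractional `(g,f,m)`-deleted graph: after deleting any `m` edges,
the resulting graph admits a fractional `(g,f)`-factor. -/
def FracDeleted {V : Type*} [Fintype V] [DecidableEq V]
    (G : SimpleGraph V) (g f : V → ℤ) (m : ℕ) : Prop :=
  ∀ H : Finset (Sym2 V), ↑H ⊆ G.edgeSet → H.card = m →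
    HasFracFactor (G.deleteEdges ↑H) g f

/-- `G` is a fractional `(g,f,n',m)`-critical deleted graph: after deleting any `n'`
vertices, the resulting induced graph is a fractional `(g,f,m)`-deleted graph. -/
def FracCriticalDeleted {V : Type*} [Fintype V] [DecidableEq V]
    (G : SimpleGraph V) (g f : V → ℤ) (n' m : ℕ) : Prop :=
  ∀ U : Finset V, U.card = n' →
    FracDeleted (G.induce ((↑U : Set V)ᶜ)) (fun x => g x.1) (fun x => f x.1) m

/-- `G` is a fractional ID-`(g,f,m)`-deleted graph: after deleting any independent set
of vertices, the resulting induced graph is a fractional `(g,f,m)`-deleted graph. -/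
def FracIDDeleted {V : Type*} [Fintype V] [DecidableEq V]
    (G : SimpleGraph V) (g f : V → ℤ) (m : ℕ) : Prop :=
  ∀ I : Set V, (∀ u ∈ I, ∀ v ∈ I, ¬ G.Adj u v) →
    FracDeleted (G.induce Iᶜ) (fun x => g x.1) (fun x => f x.1) m

theorem fracDeg_eq_sum_mk {V : Type*} [Fintype V] [DecidableEq V] (h : Sym2 V → ℝ) (x : V) :
    fracDeg h x = ∑ v, h s(x, v) := by
  unfold fracDeg
  symm
  refine Finset.sum_bij (fun v _ => s(x, v)) ?_ ?_ ?_ ?_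
  · intro v _
    simp
  · intro v _ w _ hvw
    exact Sym2.congr_right.mp hvw
  · intro e he
    obtain ⟨v, rfl⟩ := (Finset.mem_filter.mp he).2
    exact ⟨v, Finset.mem_univ _, rfl⟩
  · intro v _
    rfl

theorem sum_mul_fracDeg {V : Type*} [Fintype V] [DecidableEq V] (h : Sym2 V → ℝ) (c : V → ℝ) :
    2 * ∑ x, c x * fracDeg h x = ∑ x, ∑ v, (c x + c v) * h s(x, v) := by
  have h1 : ∑ x, c x * fracDeg h x = ∑ x, ∑ v, c x * h s(x, v) := by
    simp_rw [fracDeg_eq_sum_mk, Finset.mul_sum]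
  have h2 : ∑ x, ∑ v, c x * h s(x, v) = ∑ x, ∑ v, c v * h s(x, v) := by
    rw [Finset.sum_comm]
    simp_rw [Sym2.eq_swap]
  rw [two_mul]
  nth_rewrite 2 [h1]
  rw [h2, h1]
  simp_rw [add_mul, Finset.sum_add_distrib]

theorem integral_indicator_Ico_one (α β : ℝ) :
    ∫ θ : ℝ, (Set.Ico α β).indicator (fun _ => (1 : ℝ)) θ = max (β - α) 0 := by
  rw [MeasureTheory.integral_indicator measurableSet_Ico]
  simp [MeasureTheory.measureReal_def, ENNReal.toReal_ofReal']

theorem integrable_indicator_Ico_one (α β : ℝ) :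
    MeasureTheory.Integrable ((Set.Ico α β).indicator (fun _ => (1 : ℝ))) := by
  rw [MeasureTheory.integrable_indicator_iff measurableSet_Ico]
  simp

/-- The cut condition for fractional `(g,f)`-factors, averaged over the level sets of `c`. -/
theorem weighted_cut_nonneg {V : Type*} [Fintype V] [DecidableEq V]
    (G : SimpleGraph V) [DecidableRel G.Adj] (g f : V → ℤ)
    (hcut : ∀ S T : Finset V, Disjoint S T →
      ∑ x ∈ T, g x ≤ ∑ x ∈ S, f x + ∑ x ∈ T, (#{v | G.Adj x v ∧ v ∉ S} : ℤ))
    (c : V → ℝ) :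
    0 ≤ ∑ x, (f x : ℝ) * max (-c x) 0
      + ∑ x, ∑ v, (if G.Adj x v then max (c x - max 0 (-c v)) 0 else 0)
      - ∑ x, (g x : ℝ) * max (c x) 0 := by
  let I : ℝ → ℝ → ℝ → ℝ := fun α β => (Set.Ico α β).indicator (fun _ => (1 : ℝ))
  have hI : ∀ α β, MeasureTheory.Integrable (I α β) := integrable_indicator_Ico_one
  have hint : ∀ α β, ∫ θ, I α β θ = max (β - α) 0 := integral_indicator_Ico_one
  have hIf : ∀ x, MeasureTheory.Integrable (fun θ => (f x : ℝ) * I 0 (-c x) θ) :=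
    fun x => (hI _ _).const_mul _
  have hIg : ∀ x, MeasureTheory.Integrable (fun θ => (g x : ℝ) * I 0 (c x) θ) :=
    fun x => (hI _ _).const_mul _
  have hIe : ∀ x v, MeasureTheory.Integrable
      (fun θ => (if G.Adj x v then (1 : ℝ) else 0) * I (max 0 (-c v)) (c x) θ) :=
    fun x v => (hI _ _).const_mul _
  have key : ∀ θ : ℝ, 0 ≤ ∑ x, (f x : ℝ) * I 0 (-c x) θ
      + ∑ x, ∑ v, (if G.Adj x v then (1 : ℝ) else 0) * I (max 0 (-c v)) (c x) θ
      - ∑ x, (g x : ℝ) * I 0 (c x) θ := by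
    intro θ
    by_cases hθ : 0 ≤ θ
    · have h := hcut {x | θ < -c x} {x | θ < c x} (by
        rw [Finset.disjoint_left]
        intro x hx hx'
        simp only [Finset.mem_filter, Finset.mem_univ, true_and] at hx hx'
        linarith)
      have h' : (∑ x ∈ ({x | θ < c x} : Finset V), (g x : ℝ)) ≤
          ∑ x ∈ ({x | θ < -c x} : Finset V), (f x : ℝ) + ∑ x ∈ ({x | θ < c x} : Finset V),
            (#{v | G.Adj x v ∧ v ∉ ({x | θ < -c x} : Finset V)} : ℝ) := by
        exact_mod_cast h
      have e1 : ∑ x, (f x : ℝ) * I 0 (-c x) θ =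
          ∑ x ∈ ({x | θ < -c x} : Finset V), (f x : ℝ) := by
        rw [Finset.sum_filter]
        refine Finset.sum_congr rfl fun x _ => ?_
        simp [I, Set.indicator_apply, hθ]
      have e2 : ∑ x, (g x : ℝ) * I 0 (c x) θ =
          ∑ x ∈ ({x | θ < c x} : Finset V), (g x : ℝ) := by
        rw [Finset.sum_filter]
        refine Finset.sum_congr rfl fun x _ => ?_
        simp [I, Set.indicator_apply, hθ]
      have e3 : ∑ x, ∑ v, (if G.Adj x v then (1 : ℝ) else 0) * I (max 0 (-c v)) (c x) θ =
          ∑ x ∈ ({x | θ < c x} : Finset V),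
            (#{v | G.Adj x v ∧ v ∉ ({x | θ < -c x} : Finset V)} : ℝ) := by
        rw [Finset.sum_filter]
        refine Finset.sum_congr rfl fun x _ => ?_
        rw [Finset.card_filter]
        push_cast
        by_cases hx : θ < c x
        · rw [if_pos hx]
          refine Finset.sum_congr rfl fun v _ => ?_
          by_cases hA : G.Adj x v <;> simp [I, Set.indicator_apply, hθ, hx, hA]
        · rw [if_neg hx]
          refine Finset.sum_eq_zero fun v _ => ?_
          simp [I, hx]
      rw [e1, e2, e3]
      linarith
    · have hz : ∀ α β, 0 ≤ α → I α β θ = 0 := by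
        intro α β hα
        refine Set.indicator_of_notMem ?_ _
        rintro ⟨h1, _⟩
        exact hθ (hα.trans h1)
      have e1 : ∀ x, I 0 (-c x) θ = 0 := fun x => hz _ _ le_rfl
      have e2 : ∀ x, I 0 (c x) θ = 0 := fun x => hz _ _ le_rfl
      have e3 : ∀ x v, I (max 0 (-c v)) (c x) θ = 0 := fun x v => hz _ _ (le_max_left _ _)
      simp [e1, e2, e3]
  have hnn : 0 ≤ ∫ θ, (∑ x, (f x : ℝ) * I 0 (-c x) θ
      + ∑ x, ∑ v, (if G.Adj x v then (1 : ℝ) else 0) * I (max 0 (-c v)) (c x) θ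
      - ∑ x, (g x : ℝ) * I 0 (c x) θ) := MeasureTheory.integral_nonneg key
  rw [MeasureTheory.integral_sub, MeasureTheory.integral_add,
    MeasureTheory.integral_finsetSum, MeasureTheory.integral_finsetSum,
    MeasureTheory.integral_finsetSum] at hnn
  · simp_rw [MeasureTheory.integral_const_mul, hint] at hnn
    have e3 : ∀ x, ∫ θ, ∑ v, (if G.Adj x v then (1 : ℝ) else 0) * I (max 0 (-c v)) (c x) θ =
        ∑ v, (if G.Adj x v then max (c x - max 0 (-c v)) 0 else 0) := by
      intro x
      rw [MeasureTheory.integral_finsetSum _ fun v _ => hIe x v]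
      simp_rw [MeasureTheory.integral_const_mul, hint, ite_mul, one_mul, zero_mul]
    simp_rw [e3, sub_zero] at hnn
    exact hnn
  · exact fun x _ => hIg x
  · exact fun x _ => MeasureTheory.integrable_finsetSum _ fun v _ => hIe x v
  · exact fun x _ => hIf x
  · exact MeasureTheory.integrable_finsetSum _ fun x _ => hIf x
  · exact MeasureTheory.integrable_finsetSum _ fun x _ =>
      MeasureTheory.integrable_finsetSum _ fun v _ => hIe x v
  · exact (MeasureTheory.integrable_finsetSum _ fun x _ => hIf x).add
      (MeasureTheory.integrable_finsetSum _ fun x _ =>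
        MeasureTheory.integrable_finsetSum _ fun v _ => hIe x v)
  · exact MeasureTheory.integrable_finsetSum _ fun x _ => hIg x

theorem max_sub_posPart_add_max_sub_posPart (x y : ℝ) :
    max (x - max 0 (-y)) 0 + max (y - max 0 (-x)) 0 = max (x + y) 0 := by
  grind

/-- The Anstee criterion: the cut condition suffices for a fractional `(g,f)`-factor. -/
theorem hasFracFactor_of_cut {V : Type*} [Fintype V] [DecidableEq V]
    (G : SimpleGraph V) [DecidableRel G.Adj] (g f : V → ℤ) (hgf : ∀ x, g x ≤ f x)
    (hcut : ∀ S T : Finset V, Disjoint S T →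
      ∑ x ∈ T, g x ≤ ∑ x ∈ S, f x + ∑ x ∈ T, (#{v | G.Adj x v ∧ v ∉ S} : ℤ)) :
    HasFracFactor G g f := by
  let u : Sym2 V → ℝ := fun e => if e ∈ G.edgeSet then 1 else 0
  let D : (Sym2 V → ℝ) →ₗ[ℝ] (V → ℝ) :=
    { toFun := fun h x => fracDeg h x
      map_add' := fun h k => by
        ext x
        simp [fracDeg, Finset.sum_add_distrib]
      map_smul' := fun r h => by
        ext x
        simp [fracDeg, Finset.mul_sum] }
  let A : Set (V → ℝ) := D '' Set.Icc 0 u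
  let B : Set (V → ℝ) := Set.Icc (fun x => (g x : ℝ)) (fun x => (f x : ℝ))
  by_cases hAB : Disjoint A B
  · exfalso
    have hAc : Convex ℝ A := (convex_Icc 0 u).linear_image D
    have hAk : IsCompact A := isCompact_Icc.image D.continuous_of_finiteDimensional
    obtain ⟨φ, r, s, hr, hrs, hs⟩ :=
      geometric_hahn_banach_compact_closed hAc hAk (convex_Icc _ _) isClosed_Icc hAB
    let c : V → ℝ := fun x => φ (Pi.single x 1)
    have hφ : ∀ y : V → ℝ, φ y = ∑ x, c x * y x := by
      intro y
      conv_lhs => rw [pi_eq_sum_univ' y]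
      rw [map_sum]
      refine Finset.sum_congr rfl fun x _ => ?_
      rw [map_smul, smul_eq_mul, mul_comm]
    let C : Sym2 V → ℝ := Sym2.lift ⟨fun x v => c x + c v, fun x v => add_comm _ _⟩
    let h : Sym2 V → ℝ := fun e => if e ∈ G.edgeSet ∧ 0 < C e then 1 else 0
    have hh : h ∈ Set.Icc 0 u := by
      constructor <;> intro e <;> by_cases h1 : e ∈ G.edgeSet <;> by_cases h2 : 0 < C e <;>
        simp [h, u, h1, h2]
    have h1 := hr (D h) ⟨h, hh, rfl⟩
    let y : V → ℝ := fun x => if 0 < c x then (g x : ℝ) else (f x : ℝ)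
    have hy : y ∈ B := by
      constructor <;> intro x <;> have := hgf x <;> by_cases h2 : 0 < c x <;> simp [y, h2, this]
    have h2 := hs y hy
    rw [hφ] at h1 h2
    have h3 := weighted_cut_nonneg G g f hcut c
    have h4 : 2 * ∑ x, c x * D h x =
        ∑ x, ∑ v, (if G.Adj x v then max (c x + c v) 0 else 0) := by
      rw [show ∑ x, c x * D h x = ∑ x, c x * fracDeg h x from rfl, sum_mul_fracDeg]
      refine Finset.sum_congr rfl fun x _ => Finset.sum_congr rfl fun v _ => ?_
      by_cases hA : G.Adj x v
      · by_cases hc : 0 < c x + c v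
        · simp [h, C, hA, hc, hc.le]
        · simp [h, C, hA, hc, not_lt.mp hc]
      · simp [h, hA]
    have h5 : ∑ x, ∑ v, (if G.Adj x v then max (c x + c v) 0 else 0) =
        2 * ∑ x, ∑ v, (if G.Adj x v then max (c x - max 0 (-c v)) 0 else 0) := by
      rw [two_mul]
      nth_rewrite 3 [Finset.sum_comm]
      simp_rw [← Finset.sum_add_distrib]
      refine Finset.sum_congr rfl fun x _ => Finset.sum_congr rfl fun v _ => ?_
      by_cases hA : G.Adj x v
      · simp only [hA, hA.symm, if_true]
        exact (max_sub_posPart_add_max_sub_posPart _ _).symm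
      · have hA' : ¬ G.Adj v x := fun h => hA h.symm
        simp [hA, hA']
    have h6 : ∑ x, c x * y x = ∑ x, (g x : ℝ) * max (c x) 0 - ∑ x, (f x : ℝ) * max (-c x) 0 := by
      rw [← Finset.sum_sub_distrib]
      refine Finset.sum_congr rfl fun x _ => ?_
      by_cases hc : 0 < c x
      · simp [y, hc, hc.le, mul_comm]
      · simp [y, hc, not_lt.mp hc, mul_comm]
    linarith
  · rw [Set.not_disjoint_iff] at hAB
    obtain ⟨_, ⟨h, ⟨h0, hu⟩, rfl⟩, hg, hf⟩ := hAB
    have hle : ∀ e, h e ≤ if e ∈ G.edgeSet then 1 else 0 := hu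
    refine ⟨h, fun e => ⟨h0 e, (hle e).trans (by split_ifs <;> norm_num)⟩, fun e he => ?_,
      fun x => ⟨hg x, hf x⟩⟩
    have := hle e
    rw [if_neg he] at this
    exact le_antisymm this (h0 e)

theorem cut_arith_high (p q s t m h D : ℝ) (hp : 2 ≤ p) (hs : 0 ≤ s)
    (ht : t = 1 ∨ 2 ≤ t) (hh : h ≤ 2 * m) (hh' : h ≤ t * m)
    (hD : q * t ≤ D) (hD' : (q + m - s) * t ≤ D) : q * t ≤ p * s + D - h := by
  rcases le_total m s with hms | hms
  · nlinarith
  · rcases ht with rfl | ht <;> nlinarith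

theorem cut_arith_mixed (p q b s t m τ d D : ℝ) (hp : 2 ≤ p) (hm : 0 ≤ m)
    (hd0 : 0 ≤ d) (hd : d + 1 ≤ q) (hτ : τ ≤ d + 1) (hbp : p ≤ b) (hbq : q ≤ b)
    (hδ : b * q + p * m ≤ p * (d + s)) (hD : τ * d + (t - τ) * q ≤ D) :
    q * t ≤ p * s + D - 2 * m := by
  have h1 : τ * (q - d) ≤ (d + 1) * (q - d) := mul_le_mul_of_nonneg_right hτ (by linarith)
  have h2 : 0 ≤ (p - 2) * m := mul_nonneg (by linarith) hm
  rcases le_total q p with h | h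
  · nlinarith [mul_nonneg (sub_nonneg.2 hbp) (by linarith : (0:ℝ) ≤ q),
      mul_nonneg (sub_nonneg.2 h) (by linarith : (0:ℝ) ≤ q - d),
      mul_nonneg (by linarith : (0:ℝ) ≤ q - d) (by linarith : (0:ℝ) ≤ q - d - 1)]
  · nlinarith [mul_nonneg (sub_nonneg.2 hbq) (by linarith : (0:ℝ) ≤ q),
      mul_nonneg (sub_nonneg.2 h) hd0,
      mul_nonneg (by linarith : (0:ℝ) ≤ q - d) (by linarith : (0:ℝ) ≤ q - d - 1)]

theorem sq_sub_mul_add_sq_sub_nonneg (D k : ℤ) (hD : 0 ≤ D) :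
    0 ≤ D ^ 2 - k * D + k ^ 2 - k := by
  rcases hD.eq_or_lt with rfl | h
  · rcases le_or_gt k 0 with hk | hk <;> nlinarith
  · nlinarith [sq_nonneg (2 * k - D - 1), mul_nonneg hD (by linarith : 0 ≤ D - 1)]

theorem cut_arith_low (p q s t m τ D N : ℝ) (d₁ d₂ : ℕ) (hp : 2 ≤ p) (hq : 0 ≤ q) (hm : 0 ≤ m)
    (hN : (p + q) * (p + q + 2 * m - 2) < p * N) (hst : s + t ≤ N)
    (h12 : d₁ ≤ d₂) (hd : (d₂ : ℝ) ≤ q) (hτ : τ ≤ d₁ + 1) (hpos : 1 ≤ d₂)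
    (hσ : 2 * q * N ≤ (p + q) * (2 * s + d₁ + d₂))
    (hD : τ * d₁ + (t - τ) * d₂ ≤ D) :
    q * t < p * s + D - 2 * m + 1 := by
  have h12' : (d₁ : ℝ) ≤ d₂ := by exact_mod_cast h12
  have hpos' : (1 : ℝ) ≤ d₂ := by exact_mod_cast hpos
  have hint : (0 : ℝ) ≤ ((d₂ : ℝ) - 1) ^ 2 - ((d₂ : ℝ) - d₁) * ((d₂ : ℝ) - 1)
      + ((d₂ : ℝ) - d₁) ^ 2 - ((d₂ : ℝ) - d₁) := by
    exact_mod_cast sq_sub_mul_add_sq_sub_nonneg ((d₂ : ℤ) - 1) ((d₂ : ℤ) - d₁) (by omega)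
  generalize (d₁ : ℝ) = x at *
  generalize (d₂ : ℝ) = y at *
  by_contra! hcon
  have h1 : τ * (y - x) ≤ (x + 1) * (y - x) := mul_le_mul_of_nonneg_right hτ (by linarith)
  have h2 : (q - y) * t ≤ (q - y) * (N - s) := mul_le_mul_of_nonneg_left (by linarith) (by linarith)
  have h3 : (p + q - y) * s - (x + 1) * (y - x) - (q - y) * N - 2 * m + 1 ≤ 0 := by nlinarith
  have hpq : 0 < p + q := by linarith
  have h4 : (p + q - y) * (2 * q * N) ≤ (p + q - y) * ((p + q) * (2 * s + x + y)) :=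
    mul_le_mul_of_nonneg_left hσ (by linarith)
  have h5 : y * ((p + q) * (p + q + 2 * m - 2)) < y * (p * N) :=
    mul_lt_mul_of_pos_left hN (by linarith)
  have h6 : 0 < (p + q) * (2 * ((x + 1) * (y - x) + 2 * m - 1) + (p + q - y) * (x + y)
      - 2 * y * (p + q + 2 * m - 2)) := by nlinarith
  have h7 := (mul_pos_iff_of_pos_left hpq).1 h6
  nlinarith [mul_nonneg hm (by linarith : (0:ℝ) ≤ y - 1),
    mul_nonneg (by linarith : (0:ℝ) ≤ y - x) (by linarith : (0:ℝ) ≤ p + q - y - 2)]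

theorem card_mk_mem_le {V : Type*} [Fintype V] [DecidableEq V] (H : Finset (Sym2 V)) (x : V) :
    #{v | s(x, v) ∈ H} ≤ #{e ∈ H | x ∈ e} := by
  refine Finset.card_le_card_of_injOn (fun v => s(x, v)) (fun v hv => ?_) fun v _ w _ hvw =>
    Sym2.congr_right.mp hvw
  simpa using hv

theorem sum_card_filter_mem_le {V : Type*} [Fintype V] [DecidableEq V] (H : Finset (Sym2 V)) :
    ∑ x, #{e ∈ H | x ∈ e} ≤ 2 * #H := by
  simp_rw [Finset.card_filter]
  rw [Finset.sum_comm, mul_comm, ← smul_eq_mul]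
  refine Finset.sum_le_card_nsmul _ _ _ fun e _ => ?_
  rw [← Finset.card_filter]
  induction e with
  | _ u v =>
    refine (Finset.card_le_card (t := {u, v}) fun x hx => ?_).trans Finset.card_le_two
    simpa using hx

theorem card_adj_le_card_adj_deleteEdges_add {V : Type*} [Fintype V] [DecidableEq V]
    (G : SimpleGraph V) [DecidableRel G.Adj] (H : Finset (Sym2 V)) (S : Finset V) (x : V) :
    #{v | G.Adj x v ∧ v ∉ S} ≤
      #{v | (G.deleteEdges ↑H).Adj x v ∧ v ∉ S} + #{e ∈ H | x ∈ e} := by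
  refine le_trans ?_ (Nat.add_le_add_left (card_mk_mem_le H x) _)
  refine le_trans (Finset.card_le_card fun v hv => ?_) (Finset.card_union_le _ _)
  simp only [Finset.mem_filter, Finset.mem_univ, true_and, Finset.mem_union,
    SimpleGraph.deleteEdges_adj, Finset.mem_coe] at hv ⊢
  tauto

theorem card_adj_le_card_adj_notMem_add {V : Type*} [Fintype V] [DecidableEq V]
    (G : SimpleGraph V) [DecidableRel G.Adj] (S : Finset V) (x : V) :
    #{v | G.Adj x v} ≤ #{v | G.Adj x v ∧ v ∉ S} + #S := by
  refine le_trans (Finset.card_le_card fun v hv => ?_) (Finset.card_union_le _ _)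
  simp only [Finset.mem_filter, Finset.mem_univ, true_and, Finset.mem_union] at hv ⊢
  tauto

theorem fracDeleted_of_degree_sum {V : Type*} [Fintype V] [DecidableEq V]
    (G : SimpleGraph V) [DecidableRel G.Adj] (p q b m : ℕ) (g f : V → ℤ)
    (hp : 2 ≤ p) (hpb : p ≤ b) (hqb : q ≤ b)
    (hgf : ∀ x, g x ≤ f x) (hg : ∀ x, g x ≤ q) (hf : ∀ x, p ≤ f x)
    (hmin : ∀ x, (b : ℝ) * q + p * m ≤ p * #{v | G.Adj x v})
    (hcard : ((p : ℝ) + q) * (p + q + 2 * m - 2) < p * Fintype.card V)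
    (hsum : ∀ u v, u ≠ v → ¬ G.Adj u v →
      2 * (q : ℝ) * Fintype.card V ≤ (p + q) * (#{w | G.Adj u w} + #{w | G.Adj v w})) :
    FracDeleted G g f m := by
  intro H _ hH
  refine hasFracFactor_of_cut _ g f hgf fun S T hST => ?_
  have hgT : ∑ x ∈ T, g x ≤ q * #T := by
    simpa [mul_comm] using Finset.sum_le_card_nsmul T g q fun x _ => hg x
  have hfS : (p : ℤ) * #S ≤ ∑ x ∈ S, f x := by
    simpa [mul_comm] using Finset.card_nsmul_le_sum S f p fun x _ => hf x
  refine hgT.trans (le_trans ?_ (add_le_add_left hfS _))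
  rcases T.eq_empty_or_nonempty with rfl | hT
  · simp only [Finset.card_empty, Finset.sum_empty]
    positivity
  let d : V → ℕ := fun x => #{v | G.Adj x v ∧ v ∉ S}
  have hdeg : ∀ x, (#{v | G.Adj x v} : ℝ) ≤ d x + #S := fun x => by
    exact_mod_cast card_adj_le_card_adj_notMem_add G S x
  have hδ : ∀ x, (b : ℝ) * q + p * m ≤ p * (d x + #S) := fun x =>
    (hmin x).trans (mul_le_mul_of_nonneg_left (hdeg x) (by positivity))
  set D := ∑ x ∈ T, #{v | (G.deleteEdges ↑H).Adj x v ∧ v ∉ S} with hD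
  set h := ∑ x ∈ T, #{e ∈ H | x ∈ e} with hh
  have hdD : (∑ x ∈ T, (d x : ℝ)) ≤ D + h := by
    rw [hD, hh, ← Nat.cast_add, ← Finset.sum_add_distrib]
    exact_mod_cast Finset.sum_le_sum fun x _ => card_adj_le_card_adj_deleteEdges_add G H S x
  have hh2 : (h : ℝ) ≤ 2 * m := by
    rw [← hH]
    exact_mod_cast (Finset.sum_le_univ_sum_of_nonneg fun _ => Nat.zero_le _).trans
      (sum_card_filter_mem_le H)
  have hhT : (h : ℝ) ≤ #T * m := by
    rw [← hH]
    exact_mod_cast Finset.sum_le_card_nsmul T _ _ fun x _ => Finset.card_filter_le H _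
  have hp' : (2 : ℝ) ≤ p := by exact_mod_cast hp
  have hpb' : (p : ℝ) ≤ b := by exact_mod_cast hpb
  have hqb' : (q : ℝ) ≤ b := by exact_mod_cast hqb
  have hsT : (#S : ℝ) + #T ≤ Fintype.card V := by
    exact_mod_cast (Finset.card_union_of_disjoint hST).symm.le.trans (Finset.card_le_univ _)
  suffices hgoal : q * #T ≤ p * #S + D by
    rw [hD] at hgoal
    exact_mod_cast hgoal
  obtain ⟨x₁, hx₁, hmin₁⟩ := T.exists_min_image d hT
  by_cases hq₁ : q ≤ d x₁
  · have h1 : (q : ℝ) * #T ≤ ∑ x ∈ T, (d x : ℝ) := by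
      have := Finset.card_nsmul_le_sum T d q fun x hx => hq₁.trans (hmin₁ x hx)
      rw [smul_eq_mul, mul_comm] at this
      exact_mod_cast this
    have h2 : ((q : ℝ) + m - #S) * #T ≤ ∑ x ∈ T, (d x : ℝ) := by
      have := Finset.card_nsmul_le_sum T (fun x => (d x : ℝ)) ((q : ℝ) + m - #S) fun x _ => by
        have := hδ x
        nlinarith [mul_nonneg (sub_nonneg.2 hpb') (Nat.cast_nonneg q : (0:ℝ) ≤ q)]
      rwa [nsmul_eq_mul, mul_comm] at this
    have ht : (#T : ℝ) = 1 ∨ (2 : ℝ) ≤ #T := by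
      have := hT.card_pos
      rcases (by omega : #T = 1 ∨ 2 ≤ #T) with h | h
      · left; exact_mod_cast h
      · right; exact_mod_cast h
    have := cut_arith_high p q #S #T m h _ hp' (Nat.cast_nonneg _) ht hh2 hhT h1 h2
    have : (q : ℝ) * #T ≤ p * #S + D := by linarith
    exact_mod_cast this
  push Not at hq₁
  have hq₁' : (d x₁ : ℝ) + 1 ≤ q := by exact_mod_cast hq₁
  let N : Finset V := {x ∈ T | x = x₁ ∨ G.Adj x₁ x}
  have hNT : N ⊆ T := Finset.filter_subset _ _
  have hN : (#N : ℝ) ≤ d x₁ + 1 := by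
    have : N ⊆ insert x₁ ({v | G.Adj x₁ v ∧ v ∉ S} : Finset V) := by
      intro x hx
      obtain ⟨hxT, rfl | hadj⟩ := Finset.mem_filter.mp hx
      · exact Finset.mem_insert_self _ _
      · refine Finset.mem_insert_of_mem ?_
        simpa [hadj] using Finset.disjoint_right.mp hST hxT
    exact_mod_cast (Finset.card_le_card this).trans (Finset.card_insert_le _ _)
  have hsplit : ∀ k : ℕ, (∀ x ∈ T \ N, k ≤ d x) →
      (#N : ℝ) * d x₁ + (#T - #N) * k ≤ ∑ x ∈ T, (d x : ℝ) := by
    intro k hk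
    have h1 := Finset.card_nsmul_le_sum N (fun x => (d x : ℝ)) (d x₁) fun x hx => by
      exact_mod_cast hmin₁ x (hNT hx)
    have h2 := Finset.card_nsmul_le_sum (T \ N) (fun x => (d x : ℝ)) k fun x hx => by
      exact_mod_cast hk x hx
    rw [nsmul_eq_mul] at h1 h2
    rw [Finset.cast_card_sdiff hNT] at h2
    rw [← Finset.sum_sdiff hNT]
    linarith
  by_cases hall : ∀ x ∈ T \ N, q ≤ d x
  · have := cut_arith_mixed p q b #S #T m #N (d x₁) _ hp' (Nat.cast_nonneg _)
      (Nat.cast_nonneg _) hq₁' hN hpb' hqb' (hδ x₁) (hsplit q hall)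
    have : (q : ℝ) * #T ≤ p * #S + D := by linarith
    exact_mod_cast this
  push Not at hall
  obtain ⟨y, hy, hyq⟩ := hall
  obtain ⟨x₂, hx₂, hmin₂⟩ := (T \ N).exists_min_image d ⟨y, hy⟩
  have hq₂ : (d x₂ : ℝ) ≤ q := by exact_mod_cast (hmin₂ y hy).trans hyq.le
  obtain ⟨hx₂T, hx₂N⟩ := Finset.mem_sdiff.mp hx₂
  have hnon : x₂ ≠ x₁ ∧ ¬ G.Adj x₁ x₂ := by
    simpa [N, hx₂T] using hx₂N
  have hσ : 2 * (q : ℝ) * Fintype.card V ≤ (p + q) * (2 * #S + d x₁ + d x₂) :=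
    (hsum x₁ x₂ hnon.1.symm hnon.2).trans
      (mul_le_mul_of_nonneg_left (by linarith [hdeg x₁, hdeg x₂]) (by positivity))
  rcases Nat.eq_zero_or_pos (d x₂) with hz | hpos
  · have hz₁ : d x₁ = 0 := Nat.le_zero.mp (hz ▸ hmin₁ x₂ hx₂T)
    rw [hz, hz₁, Nat.cast_zero] at hσ
    have : (q : ℝ) * #T ≤ p * #S + D := by
      nlinarith [mul_le_mul_of_nonneg_left hsT (Nat.cast_nonneg q : (0:ℝ) ≤ q),
        (Nat.cast_nonneg D : (0:ℝ) ≤ D)]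
    exact_mod_cast this
  · have := cut_arith_low p q #S #T m #N _ (Fintype.card V) (d x₁) (d x₂) hp'
      (Nat.cast_nonneg _) (Nat.cast_nonneg _) hcard hsT (hmin₁ x₂ hx₂T) hq₂ hN hpos hσ
      (hsplit _ hmin₂)
    have : (q : ℝ) * #T < p * #S + D + 1 := by linarith
    exact Nat.lt_succ_iff.mp (by exact_mod_cast this)

theorem degree_sub_card_le_card_adj_induce_compl {V : Type*} [Fintype V] [DecidableEq V]
    (G : SimpleGraph V) [DecidableRel G.Adj] (U : Finset V) (x : ↥((↑U : Set V)ᶜ)) :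
    (G.degree x.1 : ℝ) - #U ≤ #{v | (G.induce ((↑U : Set V)ᶜ)).Adj x v} := by
  rw [sub_le_iff_le_add]
  norm_cast
  rw [← Finset.card_map (Function.Embedding.subtype _), ← SimpleGraph.card_neighborFinset_eq_degree]
  refine le_trans (Finset.card_le_card fun v hv => ?_) (Finset.card_union_le _ _)
  rw [SimpleGraph.mem_neighborFinset] at hv
  by_cases hvU : v ∈ U <;> simp [hv, hvU]

theorem statement_3 {V : Type*} [Fintype V] [DecidableEq V]
    (G : SimpleGraph V) [DecidableRel G.Adj] (a b n' m Δ : ℕ) (g f : V → ℤ)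
    (hba : a + Δ ≤ b) (ha : 2 ≤ a)
    (hmin : ∀ v : V, (G.degree v : ℝ) ≥
      (b : ℝ) * ((b : ℝ) - Δ) / ((a : ℝ) + Δ) + m + n')
    (hn : (Fintype.card V : ℝ) >
      ((a : ℝ) + b) * ((a : ℝ) + b + 2 * m - 2) / ((a : ℝ) + Δ) + n')
    (hgf : ∀ x : V, (a : ℤ) ≤ g x ∧ g x ≤ f x - (Δ : ℤ) ∧ f x - (Δ : ℤ) ≤ (b : ℤ) - (Δ : ℤ))
    (hdeg : ∀ u v : V, u ≠ v → ¬ G.Adj u v →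
      ((G.degree u : ℝ) + (G.degree v : ℝ)) ≥
        2 * (((b : ℝ) - Δ) * Fintype.card V + ((a : ℝ) + Δ) * n') / ((a : ℝ) + b)) :
    FracCriticalDeleted G g f n' m := by
  rintro U rfl
  have hcardN : Fintype.card ↥((↑U : Set V)ᶜ) + #U = Fintype.card V := by
    rw [← Finset.card_compl_add_card U, ← Fintype.card_coe (Uᶜ)]
    congr 1
    exact Fintype.card_congr (Equiv.subtypeEquivRight fun x => by simp)
  have hcardN' : (Fintype.card ↥((↑U : Set V)ᶜ) : ℝ) = Fintype.card V - #U := by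
    rw [← hcardN]
    push_cast
    ring
  have hdeg' := degree_sub_card_le_card_adj_induce_compl G U
  have hq : ((b - Δ : ℕ) : ℝ) = (b : ℝ) - Δ := Nat.cast_sub (by omega)
  have hp : (0 : ℝ) < (a : ℝ) + Δ := by positivity
  have hpq : (0 : ℝ) < (a : ℝ) + b := by positivity
  refine fracDeleted_of_degree_sum _ (a + Δ) (b - Δ) b m _ _ (by omega) (by omega) (by omega)
    (fun x => ?_) (fun x => ?_) (fun x => ?_) (fun x => ?_) ?_ fun u v huv hadj => ?_
  · have := hgf x
    omega
  · have := hgf x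
    omega
  · have := hgf x
    push_cast
    omega
  · have h1 := hmin x
    have h2 := (sub_le_sub_right h1 (#U : ℝ)).trans (hdeg' x)
    rw [add_sub_cancel_right] at h2
    have h3 := mul_le_mul_of_nonneg_left h2 hp.le
    rw [mul_add, mul_div_cancel₀ _ hp.ne'] at h3
    rw [hq]
    push_cast
    exact h3
  · rw [gt_iff_lt, ← lt_sub_iff_add_lt, div_lt_iff₀ hp, ← hcardN'] at hn
    rw [hq]
    push_cast
    linarith
  · have h1 := hdeg u v (fun h => huv (Subtype.ext h)) hadj
    rw [ge_iff_le, div_le_iff₀ hpq] at h1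
    have h2 := mul_le_mul_of_nonneg_right (add_le_add (hdeg' u) (hdeg' v)) hpq.le
    rw [hq, hcardN']
    push_cast
    linarith
end

section
/- Let G be a finite simple graph of order n, and let a, b, m, Δ be non-negative integers with b − Δ ≥ a ≥ 2, δ(G) ≥ (a+Δ)n/(b+2a+Δ) + b(b−Δ)/(a+Δ) + m, and n > (a+b+2m−2)(b+2a+Δ)/(a+Δ). Let g, f be integer-valued functions on V(G) with a ≤ g(x) ≤ f(x) − Δ ≤ b − Δ for every vertex x. If for every pair of distinct non-adjacent vertices u, v of G we have d_G(u) + d_G(v) ≥ 2(a+b)n/(b+2a+Δ), then G is a fractional ID-(g,f,m)-deleted graph. -/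
open Classical Finset

lemma arith_far {c e m N s w₁ w₂ t p σ : ℤ} (hc : 2 ≤ c) (he : 2 ≤ e) (hm : 0 ≤ m)
    (hN : (c + e) * (c + e + 2 * m - 2) < N * c) (hw₁ : 0 ≤ w₁) (hw : w₁ ≤ w₂)
    (hw₂ : 1 ≤ w₂) (hwe : w₂ ≤ e) (hst : s + t ≤ N) (hp : p ≤ w₁ + 1)
    (hσ : p * w₁ + (t - p) * w₂ ≤ σ) (hviol : c * s + σ + 1 ≤ e * t + 2 * m)
    (hdeg : 2 * e * N ≤ (2 * s + w₁ + w₂) * (c + e)) : False := by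
  have h1 : (c + e - w₂) * s ≤ (e - w₂) * N + (w₁ + 1) * (w₂ - w₁) + 2 * m - 1 := by
    nlinarith [mul_nonneg (sub_nonneg.2 hwe) (sub_nonneg.2 hst),
      mul_nonneg (sub_nonneg.2 hp) (sub_nonneg.2 hw)]
  have hce : 0 < c + e := by linarith
  have h2 : (c + e) * (2 * w₂ * (c + e + 2 * m - 2)) <
      (c + e) * ((c + e - w₂) * (w₁ + w₂) + 2 * ((w₁ + 1) * (w₂ - w₁) + 2 * m - 1)) := by
    have h3 := mul_le_mul_of_nonneg_left h1 hce.le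
    have h4 := mul_le_mul_of_nonneg_left hdeg (by linarith : 0 ≤ c + e - w₂)
    have h5 := mul_lt_mul_of_pos_left hN (by linarith : 0 < w₂)
    nlinarith
  have h6 := lt_of_mul_lt_mul_left h2 hce.le
  obtain ⟨k, rfl⟩ : ∃ k, w₁ = w₂ - k := ⟨w₂ - w₁, by ring⟩
  have hk : 0 ≤ k := by linarith
  have h7 : (w₂ - 1) ^ 2 < k * (w₂ - k) := by
    nlinarith [mul_nonneg hm (sub_nonneg.2 hw₂), mul_nonneg hk (sub_nonneg.2 hwe),
      mul_nonneg hk (sub_nonneg.2 hc)]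
  rcases hw₂.eq_or_lt with h | h
  · subst h
    have : k = 0 ∨ k = 1 := by omega
    rcases this with rfl | rfl <;> simp at h7
  · nlinarith [sq_nonneg (2 * k - w₂)]

lemma arith_near {b c e m s w₁ p : ℤ} (hc : 2 ≤ c) (hm : 0 ≤ m)
    (hbc : c ≤ b) (hbe : e ≤ b) (hw₁ : 0 ≤ w₁) (hwe : w₁ ≤ e)
    (hp : p ≤ w₁ + 1) (hviol : c * s + 1 ≤ p * (e - w₁) + 2 * m)
    (hA : b * e + m * c ≤ c * (s + w₁)) : False := by
  have h1 : c * s + 1 ≤ (w₁ + 1) * (e - w₁) + 2 * m := by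
    nlinarith [mul_nonneg (sub_nonneg.2 hp) (sub_nonneg.2 hwe)]
  have h2 : b * e - c * w₁ - (w₁ + 1) * (e - w₁) + 1 ≤ 0 := by
    nlinarith [mul_nonneg hm (sub_nonneg.2 hc)]
  rcases hwe.eq_or_lt with h | h
  · subst h; nlinarith [mul_nonneg hw₁ (sub_nonneg.2 hbc)]
  · nlinarith [mul_nonneg hw₁ (sub_nonneg.2 hbc),
      mul_nonneg (by linarith : 0 ≤ b - w₁ - 1) (sub_nonneg.2 hwe)]

section FractionalFactor

variable {W : Type*} [Fintype W] [DecidableEq W]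

noncomputable def outDeg (K : SimpleGraph W) (S : Finset W) (x : W) : ℕ :=
  (univ.filter fun y => K.Adj x y ∧ y ∉ S).card

lemma card_filter_eq_outDeg (K : SimpleGraph W) (S : Finset W) (x : W)
    [DecidablePred fun y => K.Adj x y ∧ y ∉ S] :
    (univ.filter fun y => K.Adj x y ∧ y ∉ S).card = outDeg K S x := by
  unfold outDeg
  congr

lemma fracDeg_eq_sum (h : Sym2 W → ℝ) (x : W) : fracDeg h x = ∑ y, h s(x, y) := by
  have himage : univ.filter (fun e : Sym2 W => x ∈ e) = univ.image fun y => s(x, y) := by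
    ext e
    simp [Sym2.mem_iff_exists, eq_comm]
  rw [fracDeg, himage, sum_image]
  intro y _ z _ h
  exact Sym2.congr_right.1 h

lemma integrable_indicator_one_of_bounded {A : Set ℝ} (hA : MeasurableSet A)
    (hfin : MeasureTheory.volume A ≠ ⊤) :
    MeasureTheory.Integrable (A.indicator (1 : ℝ → ℝ)) :=
  (MeasureTheory.integrable_indicator_iff hA).2 (MeasureTheory.integrableOn_const hfin)

lemma sum_posPart_le_of_cut_condition (K : SimpleGraph W) (g f c : W → ℝ)
    (hcut : ∀ S T : Finset W, Disjoint S T →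
      ∑ x ∈ T, g x ≤ ∑ x ∈ S, f x + ∑ x ∈ T, (outDeg K S x : ℝ)) :
    ∑ x, g x * max (c x) 0 ≤ ∑ x, f x * max (-c x) 0 +
      ∑ x, ∑ y, (if K.Adj x y then 1 else 0) * max (c x - max (-c y) 0) 0 := by
  let A : W → Set ℝ := fun x => Set.Ioo 0 (c x)
  let B : W → Set ℝ := fun x => Set.Ioo 0 (-c x)
  let C : W → W → Set ℝ := fun x y => Set.Ico (max (-c y) 0) (c x)
  have hpt : (fun t => ∑ x, g x * (A x).indicator (1 : ℝ → ℝ) t) ≤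
      fun t => ∑ x, f x * (B x).indicator (1 : ℝ → ℝ) t +
        ∑ x, ∑ y, (if K.Adj x y then 1 else 0) * (C x y).indicator (1 : ℝ → ℝ) t := by
    intro t
    rcases le_or_gt t 0 with ht | ht
    · have hA : ∀ x, t ∉ A x := fun x h => ht.not_gt h.1
      have hB : ∀ x, t ∉ B x := fun x h => ht.not_gt h.1
      simp only [Set.indicator_of_notMem (hA _), Set.indicator_of_notMem (hB _), mul_zero,
        sum_const_zero, zero_add]
      exact sum_nonneg fun x _ => sum_nonneg fun y _ =>
        mul_nonneg (by split_ifs <;> simp) (Set.indicator_nonneg (by simp) _)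
    · have h := hcut (univ.filter fun x => t < -c x) (univ.filter fun x => t < c x) (by
        rw [disjoint_left]
        intro x hx hx'
        simp only [mem_filter, mem_univ, true_and] at hx hx'
        linarith)
      simp only [sum_filter, outDeg, card_filter, Nat.cast_sum] at h
      refine h.trans' (le_of_eq ?_) |>.trans (le_of_eq ?_)
      · refine sum_congr rfl fun x _ => ?_
        simp [A, Set.indicator_apply, ht]
      · refine congrArg₂ _ (sum_congr rfl fun x _ => ?_) (sum_congr rfl fun x _ => ?_)
        · simp [B, Set.indicator_apply, ht]
        · by_cases hx : t < c x
          · simp only [hx, if_true]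
            refine sum_congr rfl fun y _ => ?_
            simp only [C, Set.indicator_apply, Set.mem_Ico, max_le_iff, hx, ht.le, and_true,
              mem_filter, mem_univ, true_and, not_lt]
            by_cases h1 : K.Adj x y <;> by_cases h2 : -c y ≤ t <;> simp [h1, h2]
          · simp [C, hx]
  have hAi : ∀ x, MeasureTheory.Integrable ((A x).indicator (1 : ℝ → ℝ)) := fun x =>
    integrable_indicator_one_of_bounded measurableSet_Ioo (by simp [A])
  have hBi : ∀ x, MeasureTheory.Integrable ((B x).indicator (1 : ℝ → ℝ)) := fun x =>
    integrable_indicator_one_of_bounded measurableSet_Ioo (by simp [B])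
  have hCi : ∀ x y, MeasureTheory.Integrable ((C x y).indicator (1 : ℝ → ℝ)) := fun x y =>
    integrable_indicator_one_of_bounded measurableSet_Ico (by simp [C])
  have hA1 : ∀ x, ∫ t, (A x).indicator (1 : ℝ → ℝ) t = max (c x) 0 := fun x => by
    rw [MeasureTheory.integral_indicator_one measurableSet_Ioo, Real.volume_real_Ioo, sub_zero]
  have hB1 : ∀ x, ∫ t, (B x).indicator (1 : ℝ → ℝ) t = max (-c x) 0 := fun x => by
    rw [MeasureTheory.integral_indicator_one measurableSet_Ioo, Real.volume_real_Ioo, sub_zero]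
  have hC1 : ∀ x y, ∫ t, (C x y).indicator (1 : ℝ → ℝ) t = max (c x - max (-c y) 0) 0 :=
    fun x y => by
      rw [MeasureTheory.integral_indicator_one measurableSet_Ico, Real.volume_real_Ico]
  have hL := MeasureTheory.integrable_finsetSum univ fun x (_ : x ∈ univ) =>
    (hAi x).const_mul (g x)
  have hR := MeasureTheory.integrable_finsetSum univ fun x (_ : x ∈ univ) =>
    (hBi x).const_mul (f x)
  have hR' := MeasureTheory.integrable_finsetSum univ fun x (_ : x ∈ univ) =>
    MeasureTheory.integrable_finsetSum univ fun y (_ : y ∈ univ) =>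
      (hCi x y).const_mul (if K.Adj x y then 1 else 0)
  have h := MeasureTheory.integral_mono hL (hR.add hR') hpt
  simp only [Pi.add_apply] at h
  rw [MeasureTheory.integral_add hR hR',
    MeasureTheory.integral_finsetSum _ fun x _ => (hAi x).const_mul (g x),
    MeasureTheory.integral_finsetSum _ fun x _ => (hBi x).const_mul (f x),
    MeasureTheory.integral_finsetSum _ fun x _ =>
      MeasureTheory.integrable_finsetSum univ fun y (_ : y ∈ univ) =>
        (hCi x y).const_mul (if K.Adj x y then 1 else 0)] at h
  simp_rw [MeasureTheory.integral_finsetSum _ fun y _ =>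
    (hCi _ y).const_mul (if K.Adj _ y then 1 else 0), MeasureTheory.integral_const_mul,
    hA1, hB1, hC1] at h
  exact h

lemma max_sub_max_add (p q : ℝ) :
    max (p - max (-q) 0) 0 + max (q - max (-p) 0) 0 =
      (if 0 < p + q then 1 else 0) * (p + q) := by
  split_ifs with h
  · rcases le_total q 0 with hq | hq <;> rcases le_total p 0 with hp | hp <;>
      simp [hp, hq] <;> grind
  · grind

theorem hasFracFactor_of_cut_condition (K : SimpleGraph W) (g f : W → ℤ) (hgf : ∀ x, g x ≤ f x)
    (hcut : ∀ S T : Finset W, Disjoint S T →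
      ∑ x ∈ T, g x ≤ ∑ x ∈ S, f x + ∑ x ∈ T, (outDeg K S x : ℤ)) :
    HasFracFactor K g f := by
  by_contra hno
  let D : (Sym2 W → ℝ) →ₗ[ℝ] (W → ℝ) :=
    { toFun := fracDeg
      map_add' := fun h k => by ext x; simp [fracDeg, sum_add_distrib]
      map_smul' := fun r h => by ext x; simp [fracDeg, mul_sum] }
  let P : Set (Sym2 W → ℝ) :=
    Set.univ.pi fun e => Set.Icc 0 (if e ∈ K.edgeSet then 1 else 0)
  let Q : Set (W → ℝ) := Set.univ.pi fun x => Set.Icc (g x : ℝ) (f x)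
  have hPc : Convex ℝ P := convex_pi fun _ _ => convex_Icc _ _
  have hQc : Convex ℝ Q := convex_pi fun _ _ => convex_Icc _ _
  have hPk : IsCompact P := isCompact_univ_pi fun _ => isCompact_Icc
  have hQk : IsCompact Q := isCompact_univ_pi fun _ => isCompact_Icc
  have hdisj : Disjoint (Set.image D P) Q := by
    rw [Set.disjoint_left]
    rintro _ ⟨h, hP, rfl⟩ hQ
    have hP' : ∀ e, 0 ≤ h e ∧ h e ≤ if e ∈ K.edgeSet then 1 else 0 := fun e => hP e trivial
    refine hno ⟨h, fun e => ⟨(hP' e).1, (hP' e).2.trans (by split_ifs <;> simp)⟩,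
      fun e he => ?_, fun x => hQ x trivial⟩
    have := hP' e
    rw [if_neg he] at this
    exact le_antisymm this.2 this.1
  obtain ⟨ℓ, u, v, hu, huv, hv⟩ := geometric_hahn_banach_compact_closed
    (hPc.linear_image D) (hPk.image D.continuous_of_finiteDimensional) hQc hQk.isClosed hdisj
  obtain ⟨c, hc⟩ : ∃ c : W → ℝ, ∀ y : W → ℝ, ℓ y = ∑ x, y x * c x :=
    ⟨_, fun y => by
      have := ℓ.toLinearMap.pi_apply_eq_sum_univ y
      exact this⟩
  let h : Sym2 W → ℝ := Sym2.lift ⟨fun x y => if K.Adj x y ∧ 0 < c x + c y then 1 else 0,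
    fun x y => by simp only [K.adj_comm x y, add_comm (c x)]⟩
  have hhP : h ∈ P := by
    intro e _
    induction e with | _ x y =>
    simp only [h, Sym2.lift_mk, SimpleGraph.mem_edgeSet, Set.mem_Icc]
    by_cases h1 : K.Adj x y <;> by_cases h2 : 0 < c x + c y <;> simp [h1, h2]
  have h1 := hu _ ⟨h, hhP, rfl⟩
  have h2 := hv (fun x => if 0 < c x then (g x : ℝ) else f x) fun x _ => by
    have : (g x : ℝ) ≤ f x := by exact_mod_cast hgf x
    dsimp only
    split_ifs
    · exact ⟨le_rfl, this⟩
    · exact ⟨this, le_rfl⟩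
  have h3 := sum_posPart_le_of_cut_condition K (fun x => (g x : ℝ)) (fun x => (f x : ℝ)) c
    fun S T hST => by exact_mod_cast hcut S T hST
  have h4 : ∑ x, (if 0 < c x then (g x : ℝ) else f x) * c x =
      ∑ x, (g x : ℝ) * max (c x) 0 - ∑ x, (f x : ℝ) * max (-c x) 0 := by
    rw [← sum_sub_distrib]
    refine sum_congr rfl fun x _ => ?_
    split_ifs with hx
    · rw [max_eq_left hx.le, max_eq_right (by linarith)]; ring
    · rw [max_eq_right (not_lt.1 hx), max_eq_left (by linarith)]; ring
  let φ : W → W → ℝ := fun x y => (if K.Adj x y then 1 else 0) * max (c x - max (-c y) 0) 0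
  let ψ : W → W → ℝ := fun x y => (if K.Adj x y ∧ 0 < c x + c y then 1 else 0) * c x
  have h5 : ∑ x, ∑ y, φ x y = ∑ x, ∑ y, ψ x y := by
    have hφ : ∑ x, ∑ y, φ x y = ∑ x, ∑ y, φ y x := sum_comm
    have hψ : ∑ x, ∑ y, ψ x y = ∑ x, ∑ y, ψ y x := sum_comm
    have : ∑ x, ∑ y, (φ x y + φ y x) = ∑ x, ∑ y, (ψ x y + ψ y x) := by
      refine sum_congr rfl fun x _ => sum_congr rfl fun y _ => ?_
      have := max_sub_max_add (c x) (c y)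
      simp only [φ, ψ, K.adj_comm y x, add_comm (c y) (c x)]
      by_cases hxy : K.Adj x y
      · simp only [hxy, if_true, true_and, one_mul, this]; ring
      · simp [hxy]
    simp only [sum_add_distrib] at this
    linarith
  have h6 : ℓ (D h) = ∑ x, ∑ y, ψ x y := by
    rw [hc]
    refine sum_congr rfl fun x _ => ?_
    change fracDeg h x * c x = _
    rw [fracDeg_eq_sum, sum_mul]
    rfl
  rw [hc, h4] at h2
  change _ ≤ _ + ∑ x, ∑ y, φ x y at h3
  linarith

noncomputable def edgeCount (H : Finset (Sym2 W)) (x : W) : ℕ :=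
  (H.filter fun e => x ∈ e).card

lemma outDeg_le_add_edgeCount (K : SimpleGraph W) (H : Finset (Sym2 W)) (S : Finset W) (x : W) :
    outDeg K S x ≤ outDeg (K.deleteEdges ↑H) S x + edgeCount H x := by
  have hsub : (univ.filter fun y => K.Adj x y ∧ y ∉ S) ⊆
      (univ.filter fun y => (K.deleteEdges ↑H).Adj x y ∧ y ∉ S) ∪
        (univ.filter fun y => s(x, y) ∈ H) := by
    intro y hy
    simp only [mem_filter, mem_univ, true_and, mem_union, SimpleGraph.deleteEdges_adj,
      mem_coe] at hy ⊢
    tauto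
  refine (card_le_card hsub).trans ((card_union_le _ _).trans ?_)
  refine Nat.add_le_add (card_filter_eq_outDeg _ _ _).le ?_
  refine card_le_card_of_injOn (fun y => s(x, y)) ?_ ?_
  · intro y hy
    simp at hy ⊢
    exact hy
  · intro y _ z _ h
    exact Sym2.congr_right.1 h

lemma sum_edgeCount_le {U : Type*} [DecidableEq U] (H : Finset (Sym2 U)) (T : Finset U) :
    ∑ x ∈ T, edgeCount H x ≤ 2 * H.card := by
  simp only [edgeCount, card_filter]
  rw [sum_comm, mul_comm, ← smul_eq_mul, ← sum_const]
  refine sum_le_sum fun e _ => ?_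
  rw [← card_filter]
  induction e with | _ u v =>
  refine (card_le_card (t := {u, v}) ?_).trans card_le_two
  intro x
  simp

lemma degree_le_card_add_outDeg (K : SimpleGraph W) [DecidableRel K.Adj] (S : Finset W) (x : W) :
    K.degree x ≤ S.card + outDeg K S x := by
  rw [← SimpleGraph.card_neighborFinset_eq_degree]
  rw [← card_filter_eq_outDeg]
  refine (card_le_card (t := S ∪ univ.filter fun y => K.Adj x y ∧ y ∉ S) ?_).trans
    (card_union_le _ _)
  intro y hy
  simp at hy ⊢
  tauto

theorem mul_card_le_of_degree_conditions (K : SimpleGraph W) [DecidableRel K.Adj]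
    (H : Finset (Sym2 W)) {b c e : ℤ}
    (hc : 2 ≤ c) (he : 2 ≤ e) (hbc : c ≤ b) (hbe : e ≤ b)
    (hN : (c + e) * (c + e + 2 * H.card - 2) < Fintype.card W * c)
    (hmin : ∀ x, b * e + H.card * c ≤ c * K.degree x)
    (hdeg : ∀ x y, x ≠ y → ¬ K.Adj x y →
      2 * e * Fintype.card W ≤ ((K.degree x : ℤ) + K.degree y) * (c + e))
    (S T : Finset W) (hST : Disjoint S T) :
    e * T.card ≤ c * S.card + ∑ x ∈ T, (outDeg (K.deleteEdges ↑H) S x : ℤ) := by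
  by_contra! hviol
  have hm : (0 : ℤ) ≤ H.card := by positivity
  have hs : (0 : ℤ) ≤ S.card := by positivity
  have hst : (S.card : ℤ) + T.card ≤ Fintype.card W := by
    rw [← Nat.cast_add, ← card_union_of_disjoint hST]
    exact_mod_cast card_le_univ _
  have hA : ∀ x, b * e + H.card * c ≤ c * (S.card + outDeg K S x) := fun x =>
    (hmin x).trans (mul_le_mul_of_nonneg_left
      (by exact_mod_cast degree_le_card_add_outDeg K S x) (by linarith))
  have hsumh : (∑ x ∈ T, (edgeCount H x : ℤ)) ≤ 2 * H.card := by
    exact_mod_cast sum_edgeCount_le H T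
  have hsumw : (∑ x ∈ T, (outDeg K S x : ℤ)) ≤
      ∑ x ∈ T, (outDeg (K.deleteEdges ↑H) S x : ℤ) + ∑ x ∈ T, (edgeCount H x : ℤ) := by
    rw [← sum_add_distrib]
    exact sum_le_sum fun x _ => by exact_mod_cast outDeg_le_add_edgeCount K H S x
  have hT : T.Nonempty := by
    rw [nonempty_iff_ne_empty]
    rintro rfl
    simp at hviol
    nlinarith
  have hct : c + 1 ≤ T.card := by
    by_contra! hlt
    have h1 : (T.card : ℤ) * (b * e + H.card * c) ≤
        c * (T.card * S.card + ∑ x ∈ T, (outDeg K S x : ℤ)) := by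
      have := sum_le_sum fun x (_ : x ∈ T) => hA x
      rw [sum_const, ← mul_sum, sum_add_distrib, sum_const] at this
      simpa using this
    have h2 : (∑ x ∈ T, (edgeCount H x : ℤ)) ≤ T.card * H.card := by
      rw [← nsmul_eq_mul, ← sum_const]
      exact sum_le_sum fun x _ => by exact_mod_cast card_filter_le _ _
    have h3 : c * ((S.card : ℤ) * (c - T.card) + 1) ≤ T.card * (e * (c - b)) := by
      nlinarith
    have h4 : (T.card : ℤ) * (e * (c - b)) ≤ 0 :=
      mul_nonpos_of_nonneg_of_nonpos (by positivity)
        (mul_nonpos_of_nonneg_of_nonpos (by linarith) (by linarith))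
    nlinarith [mul_nonneg hs (by linarith : 0 ≤ c - T.card)]
  obtain ⟨x₁, hx₁, hmin₁⟩ := T.exists_min_image (outDeg K S) hT
  set w₁ := outDeg K S x₁ with hw₁
  set P := T.filter fun y => y = x₁ ∨ K.Adj x₁ y with hP
  set Q := T.filter fun y => ¬ (y = x₁ ∨ K.Adj x₁ y) with hQ
  have hPQ : (P.card : ℤ) + Q.card = T.card := by
    exact_mod_cast card_filter_add_card_filter_not (s := T) fun y => y = x₁ ∨ K.Adj x₁ y
  have hsplit : (∑ x ∈ P, (outDeg K S x : ℤ)) + ∑ x ∈ Q, (outDeg K S x : ℤ) =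
      ∑ x ∈ T, (outDeg K S x : ℤ) := sum_filter_add_sum_filter_not _ _ _
  have hPsum : (P.card : ℤ) * w₁ ≤ ∑ x ∈ P, (outDeg K S x : ℤ) := by
    rw [← nsmul_eq_mul]
    exact card_nsmul_le_sum _ _ _ fun x hx => by
      exact_mod_cast hmin₁ x (mem_filter.1 hx).1
  have hQge : ∀ k : ℤ, (∀ x ∈ Q, k ≤ outDeg K S x) →
      (Q.card : ℤ) * k ≤ ∑ x ∈ Q, (outDeg K S x : ℤ) := fun k hk => by
    rw [← nsmul_eq_mul]
    exact card_nsmul_le_sum _ _ _ hk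
  have hPcard : (P.card : ℤ) ≤ w₁ + 1 := by
    have : P ⊆ insert x₁ (univ.filter fun y => K.Adj x₁ y ∧ y ∉ S) := by
      intro y hy
      rw [hP, mem_filter] at hy
      have := disjoint_right.1 hST hy.1
      simp only [mem_insert, mem_filter, mem_univ, true_and]
      tauto
    rw [hw₁, ← card_filter_eq_outDeg]
    exact_mod_cast (card_le_card this).trans (card_insert_le _ _)
  have hA₁ := hA x₁
  rw [← hw₁] at hA₁
  rcases lt_or_ge e w₁ with hew | hwe
  · have h1 : (T.card : ℤ) * w₁ ≤ ∑ x ∈ T, (outDeg K S x : ℤ) := by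
      rw [← nsmul_eq_mul]
      exact card_nsmul_le_sum _ _ _ fun x hx => by exact_mod_cast hmin₁ x hx
    nlinarith [mul_le_mul_of_nonneg_right hct (by linarith : 0 ≤ (w₁ : ℤ) - e),
      mul_nonneg hm (by linarith : 0 ≤ c - 2), mul_nonneg (by linarith : 0 ≤ b - c)
        (by linarith : 0 ≤ e)]
  by_cases hfar : ∀ x ∈ Q, e ≤ outDeg K S x
  · have h1 := hQge e hfar
    exact arith_near hc hm hbc hbe (by positivity) hwe hPcard (by nlinarith) hA₁
  push Not at hfar
  obtain ⟨z, hz, hze⟩ := hfar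
  obtain ⟨x₂, hx₂, hmin₂⟩ := Q.exists_min_image (outDeg K S) ⟨z, hz⟩
  set w₂ := outDeg K S x₂ with hw₂
  have hw₂e : (w₂ : ℤ) ≤ e := by
    have : (w₂ : ℤ) ≤ outDeg K S z := by exact_mod_cast hmin₂ z hz
    linarith
  have hx₂' := mem_filter.1 hx₂
  push Not at hx₂'
  have hw : (w₁ : ℤ) ≤ w₂ := by exact_mod_cast hmin₁ x₂ hx₂'.1
  have hB : 2 * e * Fintype.card W ≤ (2 * (S.card : ℤ) + w₁ + w₂) * (c + e) := by
    refine (hdeg x₁ x₂ hx₂'.2.1.symm hx₂'.2.2).trans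
      (mul_le_mul_of_nonneg_right ?_ (by linarith))
    have h1 : (K.degree x₁ : ℤ) ≤ S.card + w₁ := by
      exact_mod_cast degree_le_card_add_outDeg K S x₁
    have h2 : (K.degree x₂ : ℤ) ≤ S.card + w₂ := by
      exact_mod_cast degree_le_card_add_outDeg K S x₂
    linarith
  rcases Nat.eq_zero_or_pos w₂ with h0 | hpos
  · have h1 : (w₁ : ℤ) = 0 := by omega
    have h2 : (w₂ : ℤ) = 0 := by omega
    rw [h1, h2] at hB
    have h3 : 0 ≤ ∑ x ∈ T, (outDeg (K.deleteEdges ↑H) S x : ℤ) := by positivity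
    nlinarith
  · have h1 := hQge w₂ fun x hx => by exact_mod_cast hmin₂ x hx
    exact arith_far hc he hm hN (by positivity) hw (by exact_mod_cast hpos) hw₂e hst hPcard
      (σ := ∑ x ∈ T, (outDeg K S x : ℤ))
      (by rw [← hsplit, ← hPQ]; linarith [show ((P.card : ℤ) + Q.card - P.card) * w₂ = Q.card * w₂ by ring])
      (by linarith) hB

end FractionalFactor

lemma degree_le_degree_induce_compl {V : Type*} [Fintype V] [DecidableEq V] (G : SimpleGraph V)
    [DecidableRel G.Adj] (I : Set V) (v : ↥Iᶜ) :
    G.degree v ≤ (G.induce Iᶜ).degree v + I.toFinset.card := by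
  have hmap := G.map_neighborFinset_induce v
  rw [← SimpleGraph.card_neighborFinset_eq_degree, ← SimpleGraph.card_neighborFinset_eq_degree,
    ← card_map (.subtype (· ∈ Iᶜ)), hmap]
  refine (card_le_card fun y hy => ?_).trans (card_union_le _ _)
  by_cases h : y ∈ I <;> simp_all

lemma degree_add_card_le_of_forall_not_adj {V : Type*} [Fintype V] [DecidableEq V]
    (G : SimpleGraph V) [DecidableRel G.Adj] (I : Finset V) (v : V)
    (hv : ∀ u ∈ I, ¬ G.Adj v u) : G.degree v + I.card ≤ Fintype.card V := by
  rw [← SimpleGraph.card_neighborFinset_eq_degree, ← card_union_of_disjoint]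
  · exact card_le_univ _
  · rw [disjoint_right]
    intro u hu
    simpa using hv u hu

theorem statement_6 {V : Type*} [Fintype V] [DecidableEq V]
    (G : SimpleGraph V) [DecidableRel G.Adj] (a b m Δ : ℕ) (g f : V → ℤ)
    (hba : a + Δ ≤ b) (ha : 2 ≤ a)
    (hmin : ∀ v : V, (G.degree v : ℝ) ≥
      ((a : ℝ) + Δ) * Fintype.card V / ((b : ℝ) + 2 * a + Δ)
        + (b : ℝ) * ((b : ℝ) - Δ) / ((a : ℝ) + Δ) + m)
    (hn : (Fintype.card V : ℝ) >
      ((a : ℝ) + b + 2 * m - 2) * ((b : ℝ) + 2 * a + Δ) / ((a : ℝ) + Δ))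
    (hgf : ∀ x : V, (a : ℤ) ≤ g x ∧ g x ≤ f x - (Δ : ℤ) ∧ f x - (Δ : ℤ) ≤ (b : ℤ) - (Δ : ℤ))
    (hdeg : ∀ u v : V, u ≠ v → ¬ G.Adj u v →
      ((G.degree u : ℝ) + (G.degree v : ℝ)) ≥
        2 * ((a : ℝ) + b) * Fintype.card V / ((b : ℝ) + 2 * a + Δ)) :
    FracIDDeleted G g f m := by
  intro I hI H hH hHm
  obtain ⟨e, rfl⟩ : ∃ e, b = e + Δ := ⟨b - Δ, by omega⟩
  obtain ⟨c, hc⟩ : ∃ c, c = a + Δ := ⟨_, rfl⟩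
  have hc2 : (2 : ℝ) ≤ c := by exact_mod_cast (by omega : 2 ≤ c)
  have he2 : (2 : ℝ) ≤ e := by exact_mod_cast (by omega : 2 ≤ e)
  have hcR : (c : ℝ) = a + Δ := by exact_mod_cast hc
  set n : ℝ := (Fintype.card V : ℝ) with hn_def
  set i : ℝ := (I.toFinset.card : ℝ) with hi_def
  have hm0 : (0 : ℝ) ≤ m := by positivity
  have hD : ((e + Δ : ℕ) : ℝ) + 2 * a + Δ = e + 2 * c := by push_cast; linarith
  have hD0 : (0 : ℝ) < e + 2 * c := by linarith
  have hsum : (a : ℝ) + (e + Δ : ℕ) = c + e := by push_cast; linarith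
  rw [hD, hsum, ← hcR, gt_iff_lt, div_lt_iff₀ (by linarith)] at hn
  have hmin' : ∀ v : V, c * n / (e + 2 * c) + ((e + Δ : ℕ) : ℝ) * e / c + m ≤ G.degree v :=
    fun v => by
      have := hmin v
      rw [hD, ← hcR] at this
      push_cast at this ⊢
      rwa [add_sub_cancel_right] at this
  have hdeg' : ∀ u v : V, u ≠ v → ¬ G.Adj u v →
      2 * (c + e) * n ≤ (G.degree u + G.degree v) * (e + 2 * c) := fun u v huv huv' => by
    have := hdeg u v huv huv'
    rwa [hD, hsum, ge_iff_le, div_le_iff₀ hD0] at this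
  have hi : i * (e + 2 * c) ≤ c * n := by
    rcases le_or_gt I.toFinset.card 1 with h | h
    · have : i ≤ 1 := Nat.cast_le_one.2 h
      nlinarith
    · obtain ⟨u, hu, v, hv, huv⟩ := one_lt_card.1 h
      rw [Set.mem_toFinset] at hu hv
      have hbound : ∀ x ∈ I, (G.degree x : ℝ) + i ≤ n := fun x hx => by
        rw [hi_def, hn_def]
        exact_mod_cast degree_add_card_le_of_forall_not_adj G I.toFinset x
          fun y hy => hI x hx y (Set.mem_toFinset.1 hy)
      have h1 := hdeg' u v huv (hI u hu v hv)
      have h2 := mul_le_mul_of_nonneg_right (add_le_add (hbound u hu) (hbound v hv)) hD0.le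
      nlinarith
  have hcard : (Fintype.card ↥Iᶜ : ℝ) = n - i := by
    have : Fintype.card ↥Iᶜ + I.toFinset.card = Fintype.card V := by
      rw [← Set.toFinset_card, Set.toFinset_compl, card_compl]
      exact Nat.sub_add_cancel (card_le_univ _)
    rw [hn_def, hi_def, ← this]
    push_cast
    ring
  have hind : ∀ v : ↥Iᶜ, (G.degree v : ℝ) - i ≤ (G.induce Iᶜ).degree v := fun v => by
    rw [sub_le_iff_le_add, hi_def]
    exact_mod_cast degree_le_degree_induce_compl G I v
  have hi' : i ≤ c * n / (e + 2 * c) := (le_div_iff₀ hD0).2 hi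
  have hN : (c + e : ℝ) * (c + e + 2 * m - 2) < (n - i) * c := by
    have h1 : (c + e) * n ≤ (n - i) * (e + 2 * c) := by nlinarith
    have h2 : (c + e + 2 * m - 2) * (c + e) * (e + 2 * c) < (n - i) * c * (e + 2 * c) := by
      nlinarith
    have := lt_of_mul_lt_mul_right h2 hD0.le
    linarith
  refine hasFracFactor_of_cut_condition _ _ _ (fun x => by have := hgf x.1; omega)
    fun S T hST => ?_
  have hg : ∑ x ∈ T, g x.1 ≤ e * T.card := by
    rw [mul_comm, ← nsmul_eq_mul]
    exact sum_le_card_nsmul _ _ _ fun x _ => by have := hgf x.1; push_cast at this; omega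
  have hf : (c : ℤ) * S.card ≤ ∑ x ∈ S, f x.1 := by
    rw [mul_comm, ← nsmul_eq_mul]
    exact card_nsmul_le_sum _ _ _ fun x _ => by have := hgf x.1; omega
  refine hg.trans ((mul_card_le_of_degree_conditions (G.induce Iᶜ) H (b := (e + Δ : ℕ)) (c := c)
    (e := e) (by omega) (by omega) (by omega) (by omega) ?_ ?_ ?_ S T hST).trans
    (add_le_add_left hf _))
  · rw [hHm, ← @Int.cast_lt ℝ]
    push_cast
    rw [hcard]
    exact hN
  · intro x
    rw [hHm, ← @Int.cast_le ℝ]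
    have h1 := hmin' x
    have h2 := hind x
    have h3 : ((e + Δ : ℕ) : ℝ) * e / c + m ≤ (G.induce Iᶜ).degree x := by linarith
    have h4 := mul_le_mul_of_nonneg_left h3 (by linarith : (0 : ℝ) ≤ c)
    rw [mul_add, mul_div_cancel₀ _ (by linarith)] at h4
    push_cast at h4 ⊢
    linarith
  · intro x y hxy hadj
    rw [← @Int.cast_le ℝ]
    push_cast
    rw [hcard]
    have h1 := hdeg' x y (fun h => hxy (Subtype.ext h)) hadj
    have h2 := mul_le_mul_of_nonneg_right (add_le_add (hind x) (hind y)) hD0.le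
    refine le_of_mul_le_mul_right ?_ hD0
    have h3 := mul_le_mul_of_nonneg_right h2 (by linarith : (0 : ℝ) ≤ c + e)
    have h4 := mul_le_mul_of_nonneg_right h1 (by linarith : (0 : ℝ) ≤ c + e)
    nlinarith [mul_le_mul_of_nonneg_left hi (by linarith : (0 : ℝ) ≤ c)]
end
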